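/- Suppose the bitstrings l₁, …, lₙ are pairwise distinct and lₙ is the all-zeros bitstring. Suppose g₁, …, g_{k′} with k′ ≤ 2n − 1 are permutations of S, each equal to X j or Y i for some i, j ∈ I, such that in the configuration (g_{k′} ⋯ g₁ · t)(C₀) the top face is monochromatic (the map sending each (c, r) ∈ I × I to ε₁ + ε₂, where (g_{k′} ⋯ g₁ · t)⁻¹(c, r, (0, 0)) = (c′, r′, (ε₁, ε₂)), is constant). Then for every w ∈ {1, …, h}, the number of indices j ∈ {1, …, k′} with g_j = Y w or g_j = Y (−w) is odd if w ≤ n and even if w > n. -/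

import Mathlib

namespace RSq

def I (h : ℕ) : Type := {i : ℤ // i ≠ 0 ∧ |i| ≤ (h : ℤ)}

instance (h : ℕ) : DecidableEq (I h) :=
  inferInstanceAs (DecidableEq {i : ℤ // i ≠ 0 ∧ |i| ≤ (h : ℤ)})

instance (h : ℕ) : Neg (I h) :=
  ⟨fun i => ⟨-i.1, neg_ne_zero.mpr i.2.1, by rw [abs_neg]; exact i.2.2⟩⟩

@[simp] theorem I.neg_neg {h : ℕ} (i : I h) : -(-i) = i :=
  Subtype.ext (by show -(-i.1) = i.1; exact _root_.neg_neg i.1)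

abbrev S (h : ℕ) : Type := I h × I h × (ZMod 2 × ZMod 2)

@[simp] theorem zmod2_add_one_one (ε : ZMod 2) : ε + 1 + 1 = ε := by revert ε; decide

/-- Column move: flips column `j`. -/
def X {h : ℕ} (j : I h) : Equiv.Perm (S h) :=
  Function.Involutive.toPerm
    (fun s => if s.1 = j then (s.1, -s.2.1, (s.2.2.1 + 1, s.2.2.2)) else s)
    (by
      rintro ⟨c, r, ε₁, ε₂⟩
      by_cases hc : c = j <;> simp [hc])

/-- Row move: flips row `i`. -/
def Y {h : ℕ} (i : I h) : Equiv.Perm (S h) :=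
  Function.Involutive.toPerm
    (fun s => if s.2.1 = i then (-s.1, s.2.1, (s.2.2.1, s.2.2.2 + 1)) else s)
    (by
      rintro ⟨c, r, ε₁, ε₂⟩
      by_cases hr : r = i <;> simp [hr])

/-- The side-length parameter: `h = max m n + 2n`. -/
abbrev hS (n m : ℕ) : ℕ := max m n + 2 * n

def bit {m : ℕ} (w : Fin m → Bool) (c : ℤ) : Bool :=
  if hc : 1 ≤ c ∧ c ≤ (m : ℤ) then w ⟨(c - 1).toNat, by omega⟩ else false

def colIdx {n m : ℕ} (j : Fin m) : I (hS n m) :=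
  ⟨((j : ℕ) : ℤ) + 1, by
    have hj : (j : ℕ) < m := j.isLt
    have hm : m ≤ hS n m := le_trans (le_max_left m n) (Nat.le_add_right _ _)
    constructor
    · omega
    · rw [abs_of_nonneg (by omega)]; omega⟩

def rowIdx {n m : ℕ} (i : Fin n) : I (hS n m) :=
  ⟨((i : ℕ) : ℤ) + 1, by
    have hi : (i : ℕ) < n := i.isLt
    have hn : n ≤ hS n m := le_trans (le_max_right m n) (Nat.le_add_right _ _)
    constructor
    · omega
    · rw [abs_of_nonneg (by omega)]; omega⟩

/-- `aᵢ := (X 1)^{lᵢ(1)} ⋯ (X m)^{lᵢ(m)}`. -/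
def a {n m : ℕ} (l : Fin n → Fin m → Bool) (i : Fin n) : Equiv.Perm (S (hS n m)) :=
  ((List.finRange m).map (fun j => X (colIdx (n := n) j) ^ (if l i j then 1 else 0))).prod

/-- `bᵢ := aᵢ⁻¹ · (Y i) · aᵢ`. -/
def b {n m : ℕ} (l : Fin n → Fin m → Bool) (i : Fin n) : Equiv.Perm (S (hS n m)) :=
  (a l i)⁻¹ * Y (rowIdx (m := m) i) * a l i

/-- `t := a₁ · b₁ · b₂ ⋯ bₙ`. -/
def t {n m : ℕ} (hn : 0 < n) (l : Fin n → Fin m → Bool) : Equiv.Perm (S (hS n m)) :=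
  a l ⟨0, hn⟩ * ((List.finRange n).map (b l)).prod


/-- `p` maps the columns `±c` to themselves, keeping rows and column-flip parities there and
changing the row-flip parity in row `r` by `f r`. -/
def ActsByRow {h : ℕ} (c : I h) (p : Equiv.Perm (S h)) (f : I h → ZMod 2) : Prop :=
  ∀ s : S h, (((p s).1 = c ∨ (p s).1 = -c) ↔ (s.1 = c ∨ s.1 = -c)) ∧
    ((s.1 = c ∨ s.1 = -c) →
      (p s).2.1 = s.2.1 ∧ (p s).2.2.1 = s.2.2.1 ∧ (p s).2.2.2 = s.2.2.2 + f s.2.1)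

theorem X_apply {h : ℕ} (j : I h) (s : S h) :
    X j s = if s.1 = j then (s.1, -s.2.1, (s.2.2.1 + 1, s.2.2.2)) else s := rfl

theorem Y_apply {h : ℕ} (i : I h) (s : S h) :
    Y i s = if s.2.1 = i then (-s.1, s.2.1, (s.2.2.1, s.2.2.2 + 1)) else s := rfl

theorem X_injective {h : ℕ} : Function.Injective (X (h := h)) := by
  intro i j hij
  by_contra hne
  have := congrArg (fun s : S h => s.2.2.1) (Equiv.congr_fun hij (i, i, (0, 0)))
  simp [X_apply, hne] at this

theorem Y_injective {h : ℕ} : Function.Injective (Y (h := h)) := by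
  intro i j hij
  by_contra hne
  have := congrArg (fun s : S h => s.2.2.2) (Equiv.congr_fun hij (i, i, (0, 0)))
  simp [Y_apply, hne] at this

theorem X_ne_Y {h : ℕ} (i j : I h) : X i ≠ Y j := by
  intro hij
  have := congrArg (fun s : S h => s.2.2.1) (Equiv.congr_fun hij (i, j, (0, 0)))
  simp [X_apply, Y_apply] at this

theorem I.neg_eq_iff {h : ℕ} (i j : I h) : -i = j ↔ i = -j :=
  ⟨fun H => by rw [← H, I.neg_neg], fun H => by rw [H, I.neg_neg]⟩

theorem I.ne_neg {h : ℕ} (i : I h) : i ≠ -i := by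
  intro H
  have h1 : i.1 = -i.1 := congrArg Subtype.val H
  have h2 := i.2.1
  omega

namespace ActsByRow

variable {h : ℕ} {c : I h} {p q : Equiv.Perm (S h)} {f g : I h → ZMod 2}

theorem one : ActsByRow c 1 0 := fun s => by simp

theorem mul (hp : ActsByRow c p f) (hq : ActsByRow c q g) : ActsByRow c (p * q) (f + g) := by
  intro s
  rw [Equiv.Perm.mul_apply]
  refine ⟨(hp _).1.trans (hq s).1, fun hs => ?_⟩
  obtain ⟨h1, h2, h3⟩ := (hq s).2 hs
  obtain ⟨k1, k2, k3⟩ := (hp (q s)).2 ((hq s).1.2 hs)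
  refine ⟨k1.trans h1, k2.trans h2, ?_⟩
  rw [k3, h3, h1, Pi.add_apply]
  ring

theorem inv (hp : ActsByRow c p f) : ActsByRow c p⁻¹ (-f) := by
  intro s
  have H := hp (p⁻¹ s)
  rw [← Equiv.Perm.mul_apply, mul_inv_cancel, Equiv.Perm.one_apply] at H
  refine ⟨H.1.symm, fun hs => ?_⟩
  obtain ⟨h1, h2, h3⟩ := H.2 (H.1.1 hs)
  refine ⟨h1.symm, h2.symm, ?_⟩
  rw [h3, h1, Pi.neg_apply]
  ring

theorem list_prod {α : Type*} (L : List α) (P : α → Equiv.Perm (S h)) (F : α → I h → ZMod 2)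
    (H : ∀ x ∈ L, ActsByRow c (P x) (F x)) : ActsByRow c (L.map P).prod (L.map F).sum := by
  induction L with
  | nil => exact one
  | cons x L ih =>
    rw [List.map_cons, List.map_cons, List.prod_cons, List.sum_cons]
    exact (H x (by simp)).mul (ih fun y hy => H y (by simp [hy]))

theorem X {j : I h} (h1 : j ≠ c) (h2 : j ≠ -c) : ActsByRow c (X j) 0 := by
  intro s
  rw [X_apply]
  split_ifs with hs
  · simp [hs, h1, h2]
  · simp

theorem Y (c i : I h) : ActsByRow c (Y i) (Pi.single i 1) := by
  intro s
  rw [Y_apply]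
  split_ifs with hs
  · simp only [I.neg_eq_iff, I.neg_neg, hs, Pi.single_eq_same]
    exact ⟨or_comm, fun _ => ⟨trivial, trivial, trivial⟩⟩
  · simp [Pi.single_eq_of_ne hs]

end ActsByRow

theorem actsByRow_a {n m : ℕ} {c : I (hS n m)} (hc : (m : ℤ) < c.1) (l : Fin n → Fin m → Bool)
    (i : Fin n) : ActsByRow c (a l i) 0 := by
  have H := ActsByRow.list_prod (c := c) (List.finRange m)
    (fun j => X (colIdx (n := n) j) ^ (if l i j then 1 else 0)) (fun _ => 0) (by
      intro j _
      split_ifs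
      · rw [pow_one]
        have hj := j.isLt
        refine ActsByRow.X (fun H => ?_) (fun H => ?_)
        · have : ((j : ℕ) : ℤ) + 1 = c.1 := congrArg Subtype.val H
          omega
        · have : ((j : ℕ) : ℤ) + 1 = -c.1 := congrArg Subtype.val H
          omega
      · exact ActsByRow.one)
  simpa [a] using H

theorem actsByRow_b {n m : ℕ} {c : I (hS n m)} (hc : (m : ℤ) < c.1) (l : Fin n → Fin m → Bool)
    (i : Fin n) : ActsByRow c (b l i) (Pi.single (rowIdx i) 1) := by
  have H := ((actsByRow_a hc l i).inv.mul (ActsByRow.Y c (rowIdx (m := m) i))).mul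
    (actsByRow_a hc l i)
  simpa [b] using H

theorem actsByRow_t {n m : ℕ} {c : I (hS n m)} (hc : (m : ℤ) < c.1) (hn : 0 < n)
    (l : Fin n → Fin m → Bool) :
    ActsByRow c (t hn l) (fun r => if 0 < r.1 ∧ r.1 ≤ n then 1 else 0) := by
  have H := (actsByRow_a hc l ⟨0, hn⟩).mul
    (ActsByRow.list_prod (List.finRange n) (b l) _ fun i _ => actsByRow_b hc l i)
  rw [t]
  convert H using 1
  funext r
  rw [zero_add, ← List.ofFn_eq_map, List.sum_ofFn, Finset.sum_apply]
  split_ifs with hr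
  · have hlt : (r.1 - 1).toNat < n := by omega
    have hri : ∀ i : Fin n, r = rowIdx i ↔ i = ⟨(r.1 - 1).toNat, hlt⟩ := by
      intro i
      rw [Fin.ext_iff]
      constructor
      · rintro rfl
        simp [rowIdx]
      · intro hi
        apply Subtype.ext
        change r.1 = ((i : ℕ) : ℤ) + 1
        simp only at hi
        omega
    simp [Pi.single_apply, hri]
  · refine (Finset.sum_eq_zero fun i _ => Pi.single_eq_of_ne ?_ _).symm
    rintro rfl
    have := i.isLt
    exact hr ⟨by simp only [rowIdx]; omega, by simp only [rowIdx]; omega⟩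

theorem exists_unused_index {α : Type*} {h N n k : ℕ} (hN : N + 2 * n ≤ h) (hk : k < 2 * n)
    {Z : I h → α} (hZ : Function.Injective Z) (g : Fin k → α) :
    ∃ c : I h, (N : ℤ) < c.1 ∧ ∀ q, g q ≠ Z c ∧ g q ≠ Z (-c) := by
  by_contra! hcon
  let e : Fin (2 * n) → I h := fun i => ⟨N + 1 + (i : ℕ), by
    have := i.isLt
    refine ⟨by omega, ?_⟩
    rw [abs_of_nonneg (by omega)]
    omega⟩
  have hused : ∀ i, ∃ q, g q = Z (e i) ∨ g q = Z (-e i) := by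
    intro i
    obtain ⟨q, hq⟩ := hcon (e i) (by simp only [e]; omega)
    exact ⟨q, or_iff_not_imp_left.2 hq⟩
  choose φ hφ using hused
  have hinj : Function.Injective φ := by
    intro i j hij
    have hi := hφ i
    have hj := hφ j
    rw [hij] at hi
    have habs : (e i).1 = (e j).1 ∨ (e i).1 = -(e j).1 ∨ -(e i).1 = (e j).1 ∨
        -(e i).1 = -(e j).1 := by
      rcases hi with hi | hi <;> rcases hj with hj | hj <;>
        have := congrArg Subtype.val (hZ (hi.symm.trans hj))
      · exact Or.inl this
      · exact Or.inr (Or.inl this)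
      · exact Or.inr (Or.inr (Or.inl this))
      · exact Or.inr (Or.inr (Or.inr this))
    simp only [e] at habs
    apply Fin.ext
    omega
  have := Fintype.card_le_of_injective φ hinj
  simp only [Fintype.card_fin] at this
  omega

open Classical in
theorem actsByRow_moves {h k : ℕ} {c : I h} {g : Fin k → Equiv.Perm (S h)}
    (hmoves : ∀ q, (∃ j, g q = X j) ∨ (∃ i, g q = Y i))
    (hc : ∀ q, g q ≠ X c ∧ g q ≠ X (-c)) :
    ActsByRow c (List.ofFn g).reverse.prod (fun r => (Nat.card {q // g q = Y r} : ZMod 2)) := by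
  have H := ActsByRow.list_prod (c := c) (List.finRange k).reverse g
    (fun q r => if g q = Y r then 1 else 0) (by
      intro q _
      rcases hmoves q with ⟨j, hj⟩ | ⟨i, hi⟩
      · have hq := hc q
        rw [hj] at hq ⊢
        simp only [X_ne_Y, if_false]
        exact ActsByRow.X (fun e => hq.1 (e ▸ rfl)) (fun e => hq.2 (e ▸ rfl))
      · rw [hi]
        convert ActsByRow.Y c i using 1
        funext r
        simp [Pi.single_apply, Y_injective.eq_iff, eq_comm])
  rw [List.map_reverse, List.map_reverse, ← List.ofFn_eq_map, ← List.ofFn_eq_map,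
    List.sum_reverse, List.sum_ofFn] at H
  convert H using 1
  funext r
  rw [Finset.sum_apply, Finset.sum_boole, Nat.card_eq_fintype_card, Fintype.card_subtype]

theorem card_eq_or_eq {ι α : Type*} [Finite ι] (g : ι → α) {x y : α} (hxy : x ≠ y) :
    Nat.card {q // g q = x ∨ g q = y} = Nat.card {q // g q = x} + Nat.card {q // g q = y} := by
  classical
  have := Fintype.ofFinite ι
  simp only [Nat.card_eq_fintype_card, Fintype.card_subtype]
  rw [Finset.filter_or, Finset.card_union_of_disjoint]
  exact Finset.disjoint_filter.2 fun q _ h1 h2 => hxy (h1.symm.trans h2)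

/-- parity of the number of index-w row moves. -/
theorem stmt_6 (n m : ℕ) (hn : 0 < n) (hm : 0 < m) (l : Fin n → Fin m → Bool)
    (hdist : Function.Injective l)
    (hlast : l ⟨n - 1, by omega⟩ = fun _ => false)
    (k' : ℕ) (hk : k' ≤ 2 * n - 1) (g : Fin k' → Equiv.Perm (S (hS n m)))
    (hmoves : ∀ q, (∃ j, g q = X j) ∨ (∃ i, g q = Y i))
    (hmono : ∃ v : ZMod 2, ∀ c r : I (hS n m),
      (((List.ofFn g).reverse.prod * t hn l)⁻¹
          (c, r, ((0 : ZMod 2), (0 : ZMod 2)))).2.2.1 +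
        (((List.ofFn g).reverse.prod * t hn l)⁻¹
          (c, r, ((0 : ZMod 2), (0 : ZMod 2)))).2.2.2 = v) :
    ∀ w : I (hS n m), 0 < w.1 →
      (w.1 ≤ (n : ℤ) →
        Odd (Nat.card {q : Fin k' // g q = Y w ∨ g q = Y (-w)})) ∧
      ((n : ℤ) < w.1 →
        Even (Nat.card {q : Fin k' // g q = Y w ∨ g q = Y (-w)})) := by
  obtain ⟨v, hv⟩ := hmono
  obtain ⟨c, hcm, hc⟩ := exists_unused_index (h := hS n m) (N := m) (n := n)
    (Nat.add_le_add_right (le_max_left m n) _) (by omega) X_injective g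
  obtain ⟨r₀, hrn, hr₀⟩ := exists_unused_index (h := hS n m) (N := n) (n := n)
    (Nat.add_le_add_right (le_max_right m n) _) (by omega) Y_injective g
  have hact := ((actsByRow_moves hmoves hc).mul (actsByRow_t hcm hn l)).inv
  have hrow : ∀ r : I (hS n m), (Nat.card {q // g q = Y r} : ZMod 2) +
      (if 0 < r.1 ∧ r.1 ≤ n then 1 else 0) = v := by
    intro r
    obtain ⟨-, h1, h2⟩ := (hact (c, r, (0, 0))).2 (Or.inl rfl)
    have hvr := hv c r
    rw [h1, h2] at hvr
    rw [add_comm]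
    simpa [ZMod.neg_eq_self_mod_two] using hvr
  have hv0 : v = 0 := by
    have hempty : IsEmpty {q // g q = Y r₀} := ⟨fun q => (hr₀ q.1).1 q.2⟩
    rw [← hrow r₀, Nat.card_of_isEmpty, if_neg (by omega)]
    simp
  intro w hw
  have hneg : (Nat.card {q // g q = Y (-w)} : ZMod 2) = 0 := by
    have H := hrow (-w)
    have hval : (-w).1 = -w.1 := rfl
    rwa [if_neg (by omega), add_zero, hv0] at H
  have hpos := hrow w
  rw [card_eq_or_eq g (Y_injective.ne (I.ne_neg w))]
  refine ⟨fun hwn => ?_, fun hwn => ?_⟩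
  · rw [← ZMod.natCast_eq_one_iff_odd, Nat.cast_add, hneg, add_zero]
    rw [if_pos ⟨hw, hwn⟩, hv0] at hpos
    rw [eq_neg_of_add_eq_zero_left hpos, ZMod.neg_eq_self_mod_two]
  · rw [← ZMod.natCast_eq_zero_iff_even, Nat.cast_add, hneg, add_zero]
    rwa [if_neg (by omega), add_zero, hv0] at hpos

end RSq
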